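/- arXiv:2508.17682 — 3 statements merged into one kernel-verified Lean document; each statement's English description precedes it below -/
import Mathlib

section
/- There exist two non-isomorphic finite simple graphs, each on exactly 8 vertices, that have the same Kromatic symmetric function. -/
/-- The Kromatic symmetric function of a simple graph `G`, as a formal power
series over `ℤ` in variables indexed by the positive integers.  The coefficient
of the monomial `∏ i, x i ^ d i` is the number of proper set colorings
`κ : V → Finset ℕ+` (each vertex gets a finite nonempty set of colors, adjacent
vertices get disjoint sets) such that for every color `i`, exactly `d i`
vertices `v` satisfy `i ∈ κ v`. -/
noncomputable def KSF {V : Type} (G : SimpleGraph V) : MvPowerSeries ℕ+ ℤ :=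
  fun d => (Nat.card {κ : V → Finset ℕ+ //
    (∀ v, (κ v).Nonempty) ∧
    (∀ ⦃a b : V⦄, G.Adj a b → Disjoint (κ a) (κ b)) ∧
    (∀ i : ℕ+, Nat.card {v : V // i ∈ κ v} = d i)} : ℤ)

open Finset

section Coefficients

variable {V : Type} [Fintype V] [DecidableEq V] (G : SimpleGraph V) [DecidableRel G.Adj]

/-- The independent sets of size `k` of `G` contained in `W`. -/
def indepSets (W : Finset V) (k : ℕ) : Finset (Finset V) :=
  {I ∈ W.powersetCard k | ∀ a ∈ I, ∀ b ∈ I, ¬ G.Adj a b}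

variable {G} in
theorem mem_indepSets {W I : Finset V} {k : ℕ} :
    I ∈ indepSets G W k ↔ (I ⊆ W ∧ #I = k) ∧ ∀ a ∈ I, ∀ b ∈ I, ¬ G.Adj a b := by
  simp [indepSets, mem_powersetCard]

/-- The families of independent sets of sizes prescribed by `d` that cover all vertices. -/
def indepCovers (d : ℕ+ →₀ ℕ) : Finset (d.support → Finset V) :=
  {S ∈ Fintype.piFinset fun i : d.support => indepSets G univ (d i) | ∀ v, ∃ i, v ∈ S i}

/-- A proper set coloring amounts to the family of its color classes. -/
theorem KSF_apply_eq_card_indepCovers (d : ℕ+ →₀ ℕ) :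
    KSF G d = (#(indepCovers G d) : ℤ) := by
  have hcard (κ : V → Finset ℕ+) (i : ℕ+) :
      Nat.card {v : V // i ∈ κ v} = #{v | i ∈ κ v} := by
    rw [Nat.card_eq_fintype_card, Fintype.card_subtype]
  have hsupp {κ : V → Finset ℕ+} (hκ : ∀ i, Nat.card {v : V // i ∈ κ v} = d i) {i : ℕ+} {v : V}
      (hi : i ∈ κ v) : i ∈ d.support := by
    rw [Finsupp.mem_support_iff, ← hκ, hcard]
    exact (card_pos.2 ⟨v, by simpa using hi⟩).ne'
  rw [KSF, ← Fintype.card_coe, ← Nat.card_eq_fintype_card]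
  congr 1
  refine Nat.card_congr
    { toFun := fun κ => ⟨fun i => {v | (i : ℕ+) ∈ κ.1 v}, ?_⟩
      invFun := fun S =>
        ⟨fun v => ({i | v ∈ S.1 i} : Finset d.support).map ⟨_, Subtype.val_injective⟩, ?_, ?_, ?_⟩
      left_inv := ?_
      right_inv := ?_ }
  · obtain ⟨κ, hne, hdisj, hκ⟩ := κ
    simp only [indepCovers, mem_filter, Fintype.mem_piFinset, mem_indepSets, subset_univ, true_and,
      mem_univ]
    refine ⟨fun i => ⟨by rw [← hκ, hcard], fun a ha b hb hab => ?_⟩, fun v => ?_⟩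
    · exact disjoint_left.1 (hdisj hab) ha hb
    · obtain ⟨i, hi⟩ := hne v
      exact ⟨⟨i, hsupp hκ hi⟩, hi⟩
  · intro v
    obtain ⟨S, hS⟩ := S
    obtain ⟨i, hi⟩ := (mem_filter.1 hS).2 v
    exact ⟨i, by simpa using hi⟩
  · intro a b hab
    obtain ⟨S, hS⟩ := S
    rw [disjoint_left]
    intro i hia hib
    simp only [mem_map, mem_filter, mem_univ, true_and, Function.Embedding.coeFn_mk] at hia hib
    obtain ⟨j, hj, rfl⟩ := hia
    obtain ⟨j', hj', h⟩ := hib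
    obtain rfl := Subtype.ext h
    exact (mem_indepSets.1 (Fintype.mem_piFinset.1 (mem_filter.1 hS).1 j')).2 a hj b hj' hab
  · intro i
    obtain ⟨S, hS⟩ := S
    rw [hcard]
    by_cases hi : i ∈ d.support
    · rw [← (mem_indepSets.1 (Fintype.mem_piFinset.1 (mem_filter.1 hS).1 ⟨i, hi⟩)).1.2]
      congr 1
      ext v
      simp only [mem_filter, mem_univ, true_and, mem_map, Function.Embedding.coeFn_mk]
      exact ⟨by rintro ⟨j, hj, rfl⟩; exact hj, fun hv => ⟨⟨i, hi⟩, hv, rfl⟩⟩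
    · rw [Finsupp.notMem_support_iff.1 hi, card_eq_zero, filter_eq_empty_iff]
      intro v _ hv
      obtain ⟨j, -, rfl⟩ := mem_map.1 hv
      exact hi j.2
  · rintro ⟨κ, hne, hdisj, hκ⟩
    ext v i
    simp only [mem_map, mem_filter, mem_univ, true_and, Function.Embedding.coeFn_mk]
    exact ⟨by rintro ⟨j, hj, rfl⟩; exact hj, fun hi => ⟨⟨i, hsupp hκ hi⟩, hi, rfl⟩⟩
  · rintro ⟨S, hS⟩
    ext i v
    simp

/-- Inclusion-exclusion over the set of vertices missed by a family of independent sets. -/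
theorem card_indepCovers (d : ℕ+ →₀ ℕ) :
    (#(indepCovers G d) : ℤ) =
      ∑ T : Finset V, (-1) ^ #T * ∏ i ∈ d.support, (#(indepSets G Tᶜ (d i)) : ℤ) := by
  have hcover (S : d.support → Finset V) :
      (if ∀ v, ∃ i, v ∈ S i then 1 else 0 : ℤ) =
        ∑ T : Finset V, (-1) ^ #T * if ∀ i, S i ⊆ Tᶜ then 1 else 0 := by
    have hv (v : V) : (if ∃ i, v ∈ S i then 1 else 0 : ℤ) =
        1 + -(if ∀ i, v ∉ S i then 1 else 0) := by
      by_cases h : ∃ i, v ∈ S i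
      · have h' : ¬ ∀ i, v ∉ S i := by simpa using h
        rw [if_pos h, if_neg h']; rfl
      · have h' : ∀ i, v ∉ S i := by simpa using h
        rw [if_neg h, if_pos h']; rfl
    have hprod := prod_ite_zero (s := (univ : Finset V)) (p := fun v => ∃ i, v ∈ S i)
      (f := fun _ => (1 : ℤ))
    simp only [mem_univ, true_implies, prod_const_one] at hprod
    rw [← hprod, prod_congr rfl fun v _ => hv v, prod_one_add, powerset_univ]
    refine sum_congr rfl fun T _ => ?_
    rw [prod_neg, prod_ite_zero, prod_const_one]
    congr 2
    simp only [subset_iff, mem_compl, eq_iff_iff]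
    exact ⟨fun h i v hv hT => h v hT i hv, fun h v hT i hv => h i hv hT⟩
  rw [indepCovers, card_filter]
  push_cast
  rw [sum_congr rfl fun S _ => hcover S, sum_comm]
  refine sum_congr rfl fun T _ => ?_
  rw [← mul_sum, ← prod_coe_sort, ← Nat.cast_prod, ← Fintype.card_piFinset, sum_boole]
  congr 3
  ext S
  simp only [mem_filter, Fintype.mem_piFinset, mem_indepSets, subset_univ, true_and,
    ← forall_and]
  exact forall_congr' fun i => by tauto

/-- The number of independent sets of size `k` contained in the list `l` and without neighbors in
the list `A`. -/
def indepCount : List V → List V → ℕ → ℕ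
  | _, _, 0 => 1
  | [], _, _ + 1 => 0
  | v :: l, A, k + 1 =>
    indepCount l A (k + 1) + if ∀ a ∈ A, ¬ G.Adj v a then indepCount l (v :: A) k else 0

theorem indepCount_eq_card {l : List V} (hl : l.Nodup) (A : List V) (k : ℕ) :
    indepCount G l A k = #{I ∈ indepSets G l.toFinset k | ∀ a ∈ I, ∀ b ∈ A, ¬ G.Adj a b} := by
  induction l generalizing A k with
  | nil =>
    cases k with
    | zero => simp [indepCount, indepSets, filter_singleton]
    | succ k =>
      have h : powersetCard (k + 1) (∅ : Finset V) = ∅ := powersetCard_eq_empty.2 (by simp)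
      simp [indepCount, indepSets, h]
  | cons v l ih =>
    cases k with
    | zero => simp [indepCount, indepSets, filter_singleton]
    | succ k =>
      obtain ⟨hv, hl⟩ := List.nodup_cons.1 hl
      have hv' : v ∉ l.toFinset := by simpa using hv
      rw [indepCount, ih hl, ih hl, indepSets, indepSets, indepSets, List.toFinset_cons,
        powersetCard_succ_insert hv', filter_filter, filter_filter, filter_filter, filter_union,
        card_union_of_disjoint]
      · congr 1
        rw [filter_image, card_image_of_injOn]
        · split_ifs with hA
          · congr 1
            refine filter_congr fun I _ => ?_
            simp only [forall_mem_insert, List.forall_mem_cons, G.irrefl, not_false_eq_true,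
              true_and]
            have := fun a => G.adj_comm v a
            grind
          · symm
            rw [card_eq_zero, filter_eq_empty_iff]
            exact fun I _ h => hA (h.2 v (mem_insert_self v I))
        · intro I hI J hJ hIJ
          have hmem {K : Finset V} (hK : K ∈ powersetCard k l.toFinset) : v ∉ K :=
            fun h => hv' ((mem_powersetCard.1 hK).1 h)
          have hI' := hmem (mem_filter.1 hI).1
          have hJ' := hmem (mem_filter.1 hJ).1
          rw [← erase_insert hI', ← erase_insert hJ']
          exact congrArg (fun K => K.erase v) hIJ
      · refine disjoint_filter_filter (disjoint_left.2 fun I hI hI' => ?_)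
        obtain ⟨J, -, rfl⟩ := mem_image.1 hI'
        exact hv' ((mem_powersetCard.1 hI).1 (mem_insert_self v J))

theorem card_indepSets_toFinset {l : List V} (hl : l.Nodup) (k : ℕ) :
    #(indepSets G l.toFinset k) = indepCount G l [] k := by
  simp [indepCount_eq_card G hl]

end Coefficients

/-- The numbers of independent sets of each size avoiding `T`, together with the size of `T`. -/
def indepProfile (G : SimpleGraph (Fin 8)) [DecidableRel G.Adj] (T : Finset (Fin 8)) :
    ℕ × List ℕ :=
  (#T, (List.range 9).map fun k =>
    indepCount G ((List.finRange 8).filter fun v => v ∉ T) [] k)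

theorem card_indepSets_eq_getD (G : SimpleGraph (Fin 8)) [DecidableRel G.Adj]
    (T : Finset (Fin 8)) (k : ℕ) : #(indepSets G Tᶜ k) = (indepProfile G T).2.getD k 0 := by
  by_cases hk : k < 9
  · have hT : Tᶜ = ((List.finRange 8).filter fun v => v ∉ T).toFinset := by ext; simp
    rw [hT, card_indepSets_toFinset G ((List.nodup_finRange 8).filter _)]
    simp [indepProfile, List.getD, hk]
  · have h : indepSets G Tᶜ k = ∅ := by
      refine eq_empty_of_forall_notMem fun I hI => ?_
      have h₁ := (mem_indepSets.1 hI).1.2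
      have h₂ := card_le_univ I
      simp only [Fintype.card_fin] at h₂
      omega
    simp [indepProfile, List.getD, hk, h]

theorem KSF_apply_eq_sum_indepProfile (G : SimpleGraph (Fin 8)) [DecidableRel G.Adj]
    (d : ℕ+ →₀ ℕ) :
    KSF G d = ((univ.val.map (indepProfile G)).map fun p =>
      (-1) ^ p.1 * ∏ i ∈ d.support, (p.2.getD (d i) 0 : ℤ)).sum := by
  rw [KSF_apply_eq_card_indepCovers, card_indepCovers, Multiset.map_map]
  simp only [card_indepSets_eq_getD]
  rfl

theorem KSF_eq_of_indepProfile {G H : SimpleGraph (Fin 8)} [DecidableRel G.Adj]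
    [DecidableRel H.Adj]
    (h : univ.val.map (indepProfile G) = univ.val.map (indepProfile H)) : KSF G = KSF H := by
  funext d
  rw [KSF_apply_eq_sum_indepProfile, KSF_apply_eq_sum_indepProfile, h]

/-- The graph on `Fin 8` whose edges are the given pairs. -/
def graphOfEdges (E : List (Fin 8 × Fin 8)) : SimpleGraph (Fin 8) where
  Adj a b := a ≠ b ∧ ((a, b) ∈ E ∨ (b, a) ∈ E)
  symm := ⟨fun _ _ h => ⟨h.1.symm, h.2.symm⟩⟩
  loopless := ⟨fun _ h => h.1 rfl⟩

instance (E : List (Fin 8 × Fin 8)) : DecidableRel (graphOfEdges E).Adj := fun a b =>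
  inferInstanceAs (Decidable (a ≠ b ∧ ((a, b) ∈ E ∨ (b, a) ∈ E)))

/-- The edges shared by the two graphs. -/
def commonEdges : List (Fin 8 × Fin 8) :=
  [(0, 1), (0, 2), (0, 4), (1, 3), (1, 6), (2, 5), (2, 6), (2, 7), (3, 6), (3, 7), (4, 5), (4, 6),
    (5, 7)]

/-- There exist two non-isomorphic simple graphs on exactly 8 vertices with the
same Kromatic symmetric function. -/
theorem exists_eight_vertex_nonisomorphic_same_KSF :
    ∃ G H : SimpleGraph (Fin 8), ¬ Nonempty (G ≃g H) ∧ KSF G = KSF H := by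
  refine ⟨graphOfEdges ((0, 7) :: commonEdges), graphOfEdges ((1, 7) :: commonEdges), ?_,
    KSF_eq_of_indepProfile ?_⟩
  · rintro ⟨e⟩
    have hG : ∀ v, ∑ w ∈ (graphOfEdges ((0, 7) :: commonEdges)).neighborFinset v,
        (graphOfEdges ((0, 7) :: commonEdges)).degree w ≠ 10 := by decide +kernel
    have hH : ∃ v, ∑ w ∈ (graphOfEdges ((1, 7) :: commonEdges)).neighborFinset v,
        (graphOfEdges ((1, 7) :: commonEdges)).degree w = 10 := by decide +kernel
    obtain ⟨v, hv⟩ := hH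
    refine hG (e.symm v) (Eq.trans ?_ hv)
    refine sum_equiv e.toEquiv (fun w => ?_) fun w _ => (e.degree_eq w).symm
    rw [SimpleGraph.mem_neighborFinset, SimpleGraph.mem_neighborFinset, ← e.map_adj_iff]
    simp
  · decide +kernel
end

section
/- Let G be a finite simple graph, v a vertex of G, and ν a finite multiset of positive integers. For a stable set cover C, let λ(C) denote the multiset of cardinalities of its members, and let G − v be the graph obtained from G by deleting v. Then #{ C ∈ SSC(G) : λ(C) = ν } = #{ C′ ∈ SSC(G − v) : λ(C′) = ν ∖ {1} } + #{ C ∈ SSC(G) : {v} ∉ C and λ(C) = ν } + #{ C′ ∈ SSC(G) : {v} ∉ C′ and λ(C′) = ν ∖ {1} }, where ν ∖ {1} denotes ν with one copy of 1 removed, and any term involving ν ∖ {1} is taken to be 0 if 1 does not occur in ν. -/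
/-- `C` is a stable set cover (SSC) of `G`: a finite set of nonempty stable
(independent) sets of vertices whose union is the whole vertex set. -/
def IsSSC {V : Type} (G : SimpleGraph V) (C : Finset (Finset V)) : Prop :=
  (∀ B ∈ C, B.Nonempty) ∧
  (∀ B ∈ C, ∀ u ∈ B, ∀ v ∈ B, ¬ G.Adj u v) ∧
  (∀ v : V, ∃ B ∈ C, v ∈ B)

/-- `λ(C)`: the multiset of cardinalities of the members of `C`. -/
def lambdaCard {V : Type} (C : Finset (Finset V)) : Multiset ℕ :=
  C.val.map Finset.card

/-- The graph `G − v` obtained from `G` by deleting the vertex `v`. -/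
def deleteVert {V : Type} (G : SimpleGraph V) (v : V) :
    SimpleGraph {u : V // u ≠ v} :=
  SimpleGraph.comap Subtype.val G

theorem Nat.card_subtype_eq_add {α : Type*} [Finite α] (p q : α → Prop) :
    Nat.card {x // p x} = Nat.card {x // p x ∧ q x} + Nat.card {x // p x ∧ ¬ q x} := by
  classical
  have := Fintype.ofFinite α
  simp only [Nat.card_eq_fintype_card, Fintype.card_subtype, ← Finset.filter_filter]
  exact (Finset.card_filter_add_card_filter_not q).symm

theorem Nat.card_finset_mem_eq_card_insert {α : Type*} [DecidableEq α] (a : α)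
    (p : Finset α → Prop) :
    Nat.card {C // p C ∧ a ∈ C} = Nat.card {C // p (insert a C) ∧ a ∉ C} :=
  Nat.card_congr
    { toFun := fun C => ⟨C.1.erase a, by
        rw [Finset.insert_erase C.2.2]; exact C.2.1, Finset.notMem_erase a _⟩
      invFun := fun C => ⟨insert a C.1, C.2.1, Finset.mem_insert_self a _⟩
      left_inv := fun C => Subtype.ext (Finset.insert_erase C.2.2)
      right_inv := fun C => Subtype.ext (Finset.erase_insert C.2.2) }

theorem lambdaCard_insert_singleton_eq_iff {V : Type} [DecidableEq V] {v : V}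
    {C : Finset (Finset V)} (hv : {v} ∉ C) (ν : Multiset ℕ) :
    lambdaCard (insert {v} C) = ν ↔ 1 ∈ ν ∧ lambdaCard C = ν.erase 1 := by
  have h : lambdaCard (insert {v} C) = 1 ::ₘ lambdaCard C := by
    simp [lambdaCard, Finset.insert_val_of_notMem hv]
  rw [h]
  constructor
  · rintro rfl
    simp
  · rintro ⟨h1, h2⟩
    rw [h2, Multiset.cons_erase h1]

theorem isSSC_insert_singleton_iff {V : Type} [DecidableEq V] (G : SimpleGraph V) (v : V)
    (C : Finset (Finset V)) :
    IsSSC G (insert {v} C) ↔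
      (∀ B ∈ C, B.Nonempty) ∧ (∀ B ∈ C, ∀ u ∈ B, ∀ w ∈ B, ¬ G.Adj u w) ∧
        ∀ u, u ≠ v → ∃ B ∈ C, u ∈ B := by
  simp only [IsSSC, Finset.forall_mem_insert, Finset.exists_mem_insert, Finset.mem_singleton,
    Finset.singleton_nonempty, true_and, forall_eq, SimpleGraph.irrefl, not_false_eq_true,
    or_iff_not_imp_left, ne_eq]

/-- Families of sets of vertices of `G − v`, viewed as families of sets of vertices of `G`. -/
def liftFamily {V : Type} (v : V) : Finset (Finset {u : V // u ≠ v}) ↪ Finset (Finset V) :=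
  (Finset.mapEmbedding
    (Finset.mapEmbedding (Function.Embedding.subtype (· ≠ v))).toEmbedding).toEmbedding

theorem mem_liftFamily {V : Type} {v : V} {C : Finset (Finset {u : V // u ≠ v})}
    {B : Finset V} :
    B ∈ liftFamily v C ↔ ∃ B' ∈ C, B'.map (Function.Embedding.subtype (· ≠ v)) = B := by
  simp [liftFamily]

theorem lambdaCard_liftFamily {V : Type} (v : V) (C : Finset (Finset {u : V // u ≠ v})) :
    lambdaCard (liftFamily v C) = lambdaCard C := by
  simp only [lambdaCard, liftFamily, RelEmbedding.coe_toEmbedding, Finset.mapEmbedding_apply,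
    Finset.map_val, Multiset.map_map]
  exact Multiset.map_congr rfl fun B _ => Finset.card_map _

theorem notMem_of_mem_liftFamily {V : Type} {v : V} {C : Finset (Finset {u : V // u ≠ v})}
    {B : Finset V} (hB : B ∈ liftFamily v C) : v ∉ B := by
  obtain ⟨B', -, rfl⟩ := mem_liftFamily.1 hB
  simp

theorem exists_liftFamily_eq {V : Type} {v : V} {C : Finset (Finset V)}
    (hC : ∀ B ∈ C, v ∉ B) : ∃ C', liftFamily v C' = C := by
  classical
  refine ⟨C.image (Finset.subtype (· ≠ v)), ?_⟩
  have key : ∀ B ∈ C, (B.subtype (· ≠ v)).map (Function.Embedding.subtype (· ≠ v)) = B :=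
    fun B hB => Finset.subtype_map_of_mem fun x hx hxv => hC B hB (hxv ▸ hx)
  ext B
  rw [mem_liftFamily]
  constructor
  · rintro ⟨B', hB', rfl⟩
    obtain ⟨D, hD, rfl⟩ := Finset.mem_image.1 hB'
    rwa [key D hD]
  · exact fun hB => ⟨_, Finset.mem_image_of_mem _ hB, key B hB⟩

theorem isSSC_insert_singleton_liftFamily_iff {V : Type} [DecidableEq V] (G : SimpleGraph V)
    (v : V) (C : Finset (Finset {u : V // u ≠ v})) :
    IsSSC G (insert {v} (liftFamily v C)) ↔ IsSSC (deleteVert G v) C := by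
  rw [isSSC_insert_singleton_iff]
  simp only [IsSSC, deleteVert, liftFamily, RelEmbedding.coe_toEmbedding,
    Finset.mapEmbedding_apply, Function.Embedding.subtype_apply, SimpleGraph.comap_adj,
    Subtype.forall, Finset.mem_map, exists_exists_and_eq_and, Subtype.exists, exists_and_right,
    exists_eq_right]
  aesop

theorem card_isSSC_deleteVert {V : Type} [DecidableEq V] (G : SimpleGraph V) (v : V)
    (μ : Multiset ℕ) :
    Nat.card {C : Finset (Finset {u : V // u ≠ v}) //
        IsSSC (deleteVert G v) C ∧ lambdaCard C = μ} =
      Nat.card {C : Finset (Finset V) //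
        (IsSSC G (insert {v} C) ∧ lambdaCard C = μ) ∧ ∀ B ∈ C, v ∉ B} := by
  refine Nat.card_congr (Equiv.ofBijective
    (fun C => ⟨liftFamily v C.1, ⟨(isSSC_insert_singleton_liftFamily_iff G v C.1).2 C.2.1,
      (lambdaCard_liftFamily v C.1).trans C.2.2⟩, fun _ => notMem_of_mem_liftFamily⟩)
    ⟨fun C D h => Subtype.ext ((liftFamily v).injective (congrArg Subtype.val h)), ?_⟩)
  rintro ⟨C, ⟨hC, hμ⟩, hv⟩
  obtain ⟨C', rfl⟩ := exists_liftFamily_eq hv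
  exact ⟨⟨C', (isSSC_insert_singleton_liftFamily_iff G v C').1 hC,
    (lambdaCard_liftFamily v C').symm.trans hμ⟩, rfl⟩

theorem isSSC_iff_insert_singleton {V : Type} [DecidableEq V] (G : SimpleGraph V) (v : V)
    (C : Finset (Finset V)) :
    IsSSC G C ↔ IsSSC G (insert {v} C) ∧ ∃ B ∈ C, v ∈ B := by
  rw [isSSC_insert_singleton_iff]
  constructor
  · exact fun h => ⟨⟨h.1, h.2.1, fun u _ => h.2.2 u⟩, h.2.2 v⟩
  · rintro ⟨⟨h1, h2, h3⟩, h4⟩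
    refine ⟨h1, h2, fun u => ?_⟩
    obtain rfl | hu := eq_or_ne u v
    exacts [h4, h3 u hu]

/-- For a finite simple graph `G`, a vertex `v` and a finite multiset `ν` of
positive integers, the number of SSCs of `G` with cardinality-multiset `ν`
equals the number of SSCs of `G − v` with cardinality-multiset `ν ∖ {1}`, plus
the number of SSCs `C` of `G` with `{v} ∉ C` and cardinality-multiset `ν`, plus
the number of SSCs `C′` of `G` with `{v} ∉ C′` and cardinality-multiset
`ν ∖ {1}`; the terms involving `ν ∖ {1}` are taken to be `0` when `1 ∉ ν`. -/
theorem SSC_count_delete_vertex {V : Type} [Fintype V]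
    (G : SimpleGraph V) (v : V) (ν : Multiset ℕ) (hν : ∀ n ∈ ν, 0 < n) :
    Nat.card {C : Finset (Finset V) // IsSSC G C ∧ lambdaCard C = ν}
      = (if 1 ∈ ν then
          Nat.card {C' : Finset (Finset {u : V // u ≠ v}) //
            IsSSC (deleteVert G v) C' ∧ lambdaCard C' = ν.erase 1}
        else 0)
      + Nat.card {C : Finset (Finset V) //
          IsSSC G C ∧ ({v} : Finset V) ∉ C ∧ lambdaCard C = ν}
      + (if 1 ∈ ν then
          Nat.card {C' : Finset (Finset V) //
            IsSSC G C' ∧ ({v} : Finset V) ∉ C' ∧ lambdaCard C' = ν.erase 1}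
        else 0) := by
  classical
  rw [Nat.card_subtype_eq_add _ (fun C : Finset (Finset V) => {v} ∈ C),
    Nat.card_finset_mem_eq_card_insert, add_right_comm]
  congr 1
  · by_cases h1 : 1 ∈ ν
    · rw [if_pos h1, if_pos h1,
        Nat.card_subtype_eq_add _ (fun C : Finset (Finset V) => ∃ B ∈ C, v ∈ B),
        card_isSSC_deleteVert, add_comm]
      congr 1 <;> refine Nat.card_congr (Equiv.subtypeEquivRight fun C => ?_)
      · constructor
        · rintro ⟨⟨⟨hC, hν'⟩, hv⟩, hB⟩
          push Not at hB
          exact ⟨⟨hC, ((lambdaCard_insert_singleton_eq_iff hv ν).1 hν').2⟩, hB⟩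
        · rintro ⟨⟨hC, hν'⟩, hB⟩
          have hv : {v} ∉ C := fun h => hB _ h (Finset.mem_singleton_self v)
          refine ⟨⟨⟨hC, (lambdaCard_insert_singleton_eq_iff hv ν).2 ⟨h1, hν'⟩⟩, hv⟩, ?_⟩
          push Not
          exact hB
      · rw [isSSC_iff_insert_singleton G v C]
        constructor
        · rintro ⟨⟨⟨hC, hν'⟩, hv⟩, hB⟩
          exact ⟨⟨hC, hB⟩, hv, ((lambdaCard_insert_singleton_eq_iff hv ν).1 hν').2⟩
        · rintro ⟨⟨hC, hB⟩, hv, hν'⟩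
          exact ⟨⟨⟨hC, (lambdaCard_insert_singleton_eq_iff hv ν).2 ⟨h1, hν'⟩⟩, hv⟩, hB⟩
    · rw [if_neg h1, if_neg h1, add_zero, Nat.card_eq_zero]
      exact Or.inl ⟨fun C => h1 ((lambdaCard_insert_singleton_eq_iff C.2.2 ν).1 C.2.1.2).1⟩
  · refine Nat.card_congr (Equiv.subtypeEquivRight fun C => ?_)
    rw [and_assoc, and_comm (a := lambdaCard C = ν)]
end

section
/- Let G be a finite simple graph with four distinct vertices u, v, w, z such that uz, wz, vw are edges of G and uv, uw, vz are not edges of G. Suppose there is a graph automorphism φ of G − wz (the graph G with the edge wz removed) satisfying φ(u) = z, φ(z) = u, φ(w) = v, φ(v) = w. Let H = G + uw and J = G + vz. Define A = #{ x ∈ V(G) ∖ {u,v,w,z} : xw ∈ E(G), xu ∉ E(G), xv ∉ E(G) }, B = #{ x ∈ V(G) ∖ {u,v,w,z} : xw ∈ E(G), xz ∉ E(G), xv ∉ E(G) }, A′ = #{ x ∈ V(G) ∖ {u,v,w,z} : xz ∈ E(G), xu ∉ E(G), xv ∉ E(G) }, B′ = #{ x ∈ V(G) ∖ {u,v,w,z}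 : xz ∈ E(G), xu ∉ E(G), xw ∉ E(G) }. If A + B ≠ A′ + B′, then the number of 4-element vertex subsets of H inducing a claw differs from the number of 4-element vertex subsets of J inducing a claw. -/
/-- The claw `K_{1,3}`: one center vertex (`0`) adjacent to three pairwise
non-adjacent leaves. -/
def claw : SimpleGraph (Fin 4) :=
  SimpleGraph.fromEdgeSet {s(0, 1), s(0, 2), s(0, 3)}

/-- The number of `n`-element vertex subsets of `X` whose induced subgraph is
isomorphic to the pattern graph `F`. -/
noncomputable def inducedCopyCount {V α : Type} (X : SimpleGraph V)
    (F : SimpleGraph α) (n : ℕ) : ℕ :=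
  Nat.card {S : Finset V // S.card = n ∧
    Nonempty (X.induce (S : Set V) ≃g F)}

/-- `S` has four elements, one of which is adjacent in `X` to all the others, and there are no
further edges inside `S`. -/
def IsClawSet {V : Type} (X : SimpleGraph V) (S : Finset V) : Prop :=
  S.card = 4 ∧ ∃ c ∈ S, ∀ s ∈ S, s ≠ c → X.Adj c s ∧ ∀ t ∈ S, t ≠ c → ¬ X.Adj s t

theorem claw_adj (i j : Fin 4) : claw.Adj i j ↔ i ≠ j ∧ (i = 0 ∨ j = 0) := by
  simp only [claw, SimpleGraph.fromEdgeSet_adj, Set.mem_insert_iff, Set.mem_singleton_iff]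
  revert i j
  decide

theorem isClawSet_iff {V : Type} (X : SimpleGraph V) (S : Finset V) :
    S.card = 4 ∧ Nonempty (X.induce (S : Set V) ≃g claw) ↔ IsClawSet X S := by
  classical
  refine and_congr_right fun hS => ⟨?_, ?_⟩
  · rintro ⟨e⟩
    have key : ∀ s t : (S : Set V), X.Adj s t ↔ e s ≠ e t ∧ (e s = 0 ∨ e t = 0) := by
      intro s t
      rw [← claw_adj, e.map_adj_iff, SimpleGraph.induce_adj]
    refine ⟨e.symm 0, (e.symm 0).2, fun s hs hsc => ⟨?_, fun t ht htc => ?_⟩⟩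
    · rw [key (e.symm 0) ⟨s, hs⟩]
      refine ⟨fun h => hsc ?_, by simp⟩
      rw [e.injective h]
    · rw [key ⟨s, hs⟩ ⟨t, ht⟩]
      rintro ⟨-, h | h⟩
      · exact hsc (by rw [← h, e.symm_apply_apply])
      · exact htc (by rw [← h, e.symm_apply_apply])
  · rintro ⟨c, hc, h⟩
    let f : (S : Set V) ≃ Fin 4 := Fintype.equivFinOfCardEq (by simpa using hS)
    let g := f.trans (Equiv.swap (f ⟨c, hc⟩) 0)
    have hg : ∀ s, g s = 0 ↔ (s : V) = c := by
      intro s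
      have : g ⟨c, hc⟩ = 0 := by simp [g]
      rw [← this, g.apply_eq_iff_eq, Subtype.ext_iff]
    refine ⟨⟨g, fun {s t} => ?_⟩⟩
    rw [claw_adj, hg, hg, SimpleGraph.induce_adj, g.injective.ne_iff, Ne, Subtype.ext_iff]
    obtain ⟨s, hs⟩ := s
    obtain ⟨t, ht⟩ := t
    have hcs := h s hs
    have hct := h t ht
    have := X.adj_comm s t
    have := X.ne_of_adj (a := s) (b := t)
    simp only [Finset.mem_coe] at hs ht ⊢
    grind

open scoped Classical in
theorem inducedCopyCount_claw {V : Type} [Fintype V] (X : SimpleGraph V) :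
    inducedCopyCount X claw 4 = ∑ S : Finset V, if IsClawSet X S then 1 else 0 := by
  simp only [inducedCopyCount, isClawSet_iff]
  rw [Nat.card_eq_fintype_card, Fintype.card_subtype, Finset.card_filter]

theorem IsClawSet.map {V W : Type} {X : SimpleGraph V} {Y : SimpleGraph W} (e : X ≃g Y)
    {S : Finset V} (h : IsClawSet X S) : IsClawSet Y (S.map e.toEquiv.toEmbedding) := by
  obtain ⟨hS, c, hc, h⟩ := h
  refine ⟨by simpa using hS, e c, Finset.mem_map_of_mem _ hc, ?_⟩
  have hadj : ∀ a b, Y.Adj (e a) (e b) ↔ X.Adj a b := fun a b => e.map_adj_iff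
  simp only [Finset.forall_mem_map]
  simpa [hadj] using h

theorem inducedCopyCount_claw_congr {V : Type} [Fintype V] {X Y : SimpleGraph V} (e : X ≃g Y) :
    inducedCopyCount X claw 4 = inducedCopyCount Y claw 4 := by
  simp only [inducedCopyCount, isClawSet_iff]
  refine Nat.card_congr (e.toEquiv.finsetCongr.subtypeEquiv fun S => ⟨fun h => h.map e, fun h => ?_⟩)
  have := h.map e.symm
  rw [Equiv.finsetCongr_apply, Finset.map_map] at this
  convert this
  ext
  simp

theorem IsClawSet.congr {V : Type} {X Y : SimpleGraph V} {S : Finset V}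
    (h : ∀ s ∈ S, ∀ t ∈ S, (X.Adj s t ↔ Y.Adj s t)) : IsClawSet X S ↔ IsClawSet Y S := by
  unfold IsClawSet
  grind

theorem isClawSet_sup_edge {V : Type} (X : SimpleGraph V) {a b : V} {S : Finset V}
    (h : a ∉ S ∨ b ∉ S) : IsClawSet (X ⊔ SimpleGraph.edge a b) S ↔ IsClawSet X S := by
  refine IsClawSet.congr fun s hs t ht => ?_
  rw [SimpleGraph.sup_adj, SimpleGraph.edge_adj]
  grind

theorem not_isClawSet_of_triangle {V : Type} {X : SimpleGraph V} {p q r : V} {S : Finset V}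
    (hp : p ∈ S) (hq : q ∈ S) (hr : r ∈ S) (hpq : X.Adj p q) (hpr : X.Adj p r)
    (hqr : X.Adj q r) : ¬ IsClawSet X S := by
  rintro ⟨-, c, hc, h⟩
  have := h p hp
  have := h q hq
  have := hpq.ne
  have := hpr.ne
  have := hqr.ne
  by_cases c = p <;> by_cases c = q <;> grind

theorem not_isClawSet_of_edge {V : Type} {X : SimpleGraph V} {p q r : V} {S : Finset V}
    (hp : p ∈ S) (hq : q ∈ S) (hr : r ∈ S) (hpq : X.Adj p q) (hrp : r ≠ p) (hrq : r ≠ q)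
    (hpr : ¬ X.Adj p r) (hqr : ¬ X.Adj q r) : ¬ IsClawSet X S := by
  rintro ⟨-, c, hc, h⟩
  have := h p hp
  have := h q hq
  have := h r hr
  have := hpq.ne
  have := X.adj_comm p r
  have := X.adj_comm q r
  by_cases c = p <;> by_cases c = q <;> by_cases c = r <;> grind

open scoped Classical in
/-- A claw set containing an induced path `q - p - r` is centered at `p`, so it corresponds to
a neighbor of `p` adjacent to neither `q` nor `r`. -/
theorem card_isClawSet_of_path {V : Type} [Fintype V] {X : SimpleGraph V} {p q r : V}
    (hpq : X.Adj p q) (hpr : X.Adj p r) (hne : q ≠ r) (hqr : ¬ X.Adj q r) :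
    (∑ S : Finset V, if (p ∈ S ∧ q ∈ S ∧ r ∈ S) ∧ IsClawSet X S then 1 else 0) =
      Nat.card {x : V // x ≠ p ∧ x ≠ q ∧ x ≠ r ∧ X.Adj x p ∧ ¬ X.Adj x q ∧ ¬ X.Adj x r} := by
  rw [Nat.card_eq_fintype_card, Fintype.card_subtype, ← Finset.card_filter]
  symm
  have h1 := hpq.ne
  have h2 := hpr.ne
  refine Finset.card_bij (fun x _ => {x, p, q, r}) ?_ ?_ ?_
  · intro x hx
    simp only [Finset.mem_filter, Finset.mem_univ, true_and] at hx ⊢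
    obtain ⟨hxp, hxq, hxr, ha, hb, hc⟩ := hx
    refine ⟨by simp, by simp [*], p, by simp, ?_⟩
    have := X.adj_comm
    simp only [Finset.mem_insert, Finset.mem_singleton]
    have hl := fun y => X.irrefl (v := y)
    grind
  · intro x hx y hy hxy
    simp only [Finset.mem_filter, Finset.mem_univ, true_and] at hx hy
    have : x ∈ ({y, p, q, r} : Finset V) := hxy ▸ Finset.mem_insert_self _ _
    grind
  · intro S hS
    simp only [Finset.mem_filter, Finset.mem_univ, true_and] at hS
    obtain ⟨⟨hp, hq, hr⟩, hcard, c, hc, h⟩ := hS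
    have hsub : ({p, q, r} : Finset V) ⊆ S := by grind
    have h3 : ({p, q, r} : Finset V).card = 3 := by simp [*]
    obtain ⟨x, hx⟩ := Finset.card_eq_one.mp
      (show (S \ {p, q, r}).card = 1 by rw [Finset.card_sdiff_of_subset hsub]; omega)
    have hxS : x ∈ S \ {p, q, r} := by simp [hx]
    have hcp : c = p := by
      have := h p hp
      have := h q hq
      have := h r hr
      have := X.adj_comm q r
      grind
    subst hcp
    have := X.adj_comm
    refine ⟨x, ?_, ?_⟩
    · simp only [Finset.mem_filter, Finset.mem_univ, true_and]
      grind
    · rw [← Finset.sdiff_union_of_subset hsub, hx]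
      rfl

/-- Inclusion-exclusion for the number of claws when the two edges `rp` and `rq` are added to a
graph in which `pq` is an edge and `r` is adjacent to neither `p` nor `q`. -/
theorem clawCount_add_two_edges {V : Type} [Fintype V] {K : SimpleGraph V} {p q r : V}
    (hpq : K.Adj p q) (hrp : r ≠ p) (hrq : r ≠ q) (hpr : ¬ K.Adj p r) (hqr : ¬ K.Adj q r) :
    inducedCopyCount (K ⊔ SimpleGraph.edge r p ⊔ SimpleGraph.edge r q) claw 4
      + inducedCopyCount K claw 4
      + (Nat.card {x : V // x ≠ p ∧ x ≠ q ∧ x ≠ r ∧ K.Adj x p ∧ ¬ K.Adj x q ∧ ¬ K.Adj x r}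
      + Nat.card {x : V // x ≠ q ∧ x ≠ p ∧ x ≠ r ∧ K.Adj x q ∧ ¬ K.Adj x p ∧ ¬ K.Adj x r})
      = inducedCopyCount (K ⊔ SimpleGraph.edge r p) claw 4
        + inducedCopyCount (K ⊔ SimpleGraph.edge r q) claw 4 := by
  classical
  have hne := hpq.ne
  have e1 : Nat.card {x : V // x ≠ p ∧ x ≠ q ∧ x ≠ r ∧ K.Adj x p ∧ ¬ K.Adj x q ∧ ¬ K.Adj x r} =
      ∑ S : Finset V, if (p ∈ S ∧ q ∈ S ∧ r ∈ S) ∧ IsClawSet (K ⊔ SimpleGraph.edge r p) S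
        then 1 else 0 := by
    rw [card_isClawSet_of_path]
    · refine Nat.card_congr (Equiv.subtypeEquivRight fun x => ?_)
      simp only [SimpleGraph.sup_adj, SimpleGraph.edge_adj]
      grind
    all_goals
      try simp only [SimpleGraph.sup_adj, SimpleGraph.edge_adj]
      grind
  have e2 : Nat.card {x : V // x ≠ q ∧ x ≠ p ∧ x ≠ r ∧ K.Adj x q ∧ ¬ K.Adj x p ∧ ¬ K.Adj x r} =
      ∑ S : Finset V, if (q ∈ S ∧ p ∈ S ∧ r ∈ S) ∧ IsClawSet (K ⊔ SimpleGraph.edge r q) S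
        then 1 else 0 := by
    have := hpq.symm
    rw [card_isClawSet_of_path]
    · refine Nat.card_congr (Equiv.subtypeEquivRight fun x => ?_)
      simp only [SimpleGraph.sup_adj, SimpleGraph.edge_adj]
      grind
    all_goals
      try simp only [SimpleGraph.sup_adj, SimpleGraph.edge_adj]
      grind
  simp only [e1, e2, inducedCopyCount_claw, ← Finset.sum_add_distrib]
  refine Finset.sum_congr rfl fun S _ => ?_
  by_cases hS : p ∈ S ∧ q ∈ S ∧ r ∈ S
  · obtain ⟨hp, hq, hr⟩ := hS
    have n1 := not_isClawSet_of_edge hp hq hr hpq hrp hrq hpr hqr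
    have n2 : ¬ IsClawSet (K ⊔ SimpleGraph.edge r p ⊔ SimpleGraph.edge r q) S := by
      apply not_isClawSet_of_triangle hp hq hr <;>
        simp only [SimpleGraph.sup_adj, SimpleGraph.edge_adj] <;> grind
    simp [hp, hq, hr, n1, n2]
  · by_cases h : r ∉ S ∨ q ∉ S
    · have n1 := isClawSet_sup_edge K h
      have n2 := isClawSet_sup_edge (K ⊔ SimpleGraph.edge r p) h
      simp only [n1, n2]
      grind
    · have hrp_mem : r ∉ S ∨ p ∉ S := by grind
      have n1 := isClawSet_sup_edge K hrp_mem
      have n2 := isClawSet_sup_edge (K ⊔ SimpleGraph.edge r q) hrp_mem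
      rw [sup_right_comm] at n2
      simp only [n1, n2]
      grind

/-- For an Orellana–Scott pair, under the stated neighbor-count condition, the
two graphs `H = G + uw` and `J = G + vz` contain different numbers of induced
claws.  Here `G.deleteEdges {s(w,z)}` is `G − wz` and
`G ⊔ SimpleGraph.edge a b` is `G` with the edge `ab` added. -/
theorem clawCount_ne_of_orellana_scott {V : Type} [Fintype V]
    (G : SimpleGraph V) (u v w z : V)
    (huv : u ≠ v) (huw : u ≠ w) (huz : u ≠ z)
    (hvw : v ≠ w) (hvz : v ≠ z) (hwz : w ≠ z)
    (h1 : G.Adj u z) (h2 : G.Adj w z) (h3 : G.Adj v w)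
    (h4 : ¬ G.Adj u v) (h5 : ¬ G.Adj u w) (h6 : ¬ G.Adj v z)
    (φ : G.deleteEdges {s(w, z)} ≃g G.deleteEdges {s(w, z)})
    (hφu : φ u = z) (hφz : φ z = u) (hφw : φ w = v) (hφv : φ v = w)
    (hcount :
      Nat.card {x : V // x ≠ u ∧ x ≠ v ∧ x ≠ w ∧ x ≠ z ∧
        G.Adj x w ∧ ¬ G.Adj x u ∧ ¬ G.Adj x v}
      + Nat.card {x : V // x ≠ u ∧ x ≠ v ∧ x ≠ w ∧ x ≠ z ∧
        G.Adj x w ∧ ¬ G.Adj x z ∧ ¬ G.Adj x v}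
      ≠
      Nat.card {x : V // x ≠ u ∧ x ≠ v ∧ x ≠ w ∧ x ≠ z ∧
        G.Adj x z ∧ ¬ G.Adj x u ∧ ¬ G.Adj x v}
      + Nat.card {x : V // x ≠ u ∧ x ≠ v ∧ x ≠ w ∧ x ≠ z ∧
        G.Adj x z ∧ ¬ G.Adj x u ∧ ¬ G.Adj x w}) :
    inducedCopyCount (G ⊔ SimpleGraph.edge u w) claw 4
      ≠ inducedCopyCount (G ⊔ SimpleGraph.edge v z) claw 4 := by
  have hadj : ∀ a b, (G.deleteEdges {s(w, z)}).Adj a b ↔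
      G.Adj a b ∧ ¬ (a = w ∧ b = z ∨ a = z ∧ b = w) := by
    intro a b
    simp [SimpleGraph.deleteEdges_adj]
  revert φ hadj
  generalize G.deleteEdges {s(w, z)} = K
  intro φ hφu hφz hφw hφv hadj
  have hφ : ∀ a b, K.Adj (φ a) (φ b) ↔ K.Adj a b := fun a b => φ.map_adj_iff
  have hinj : ∀ a b, φ a = φ b ↔ a = b := fun a b => φ.injective.eq_iff
  have hcomm := G.adj_comm
  have first := clawCount_add_two_edges (K := K) (p := u) (q := z) (r := w)
    (by grind) (by grind) (by grind) (by grind) (by grind)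
  have second := clawCount_add_two_edges (K := K) (p := v) (q := w) (r := z)
    (by grind) (by grind) (by grind) (by grind) (by grind)
  have hG : K ⊔ SimpleGraph.edge w z = G := by
    ext a b
    rw [SimpleGraph.sup_adj, SimpleGraph.edge_adj, hadj]
    grind
  rw [SimpleGraph.edge_comm z w, hG, sup_right_comm, hG] at second
  rw [hG, sup_right_comm, hG] at first
  have hiso : inducedCopyCount (K ⊔ SimpleGraph.edge w u) claw 4 =
      inducedCopyCount (K ⊔ SimpleGraph.edge z v) claw 4 := by
    refine inducedCopyCount_claw_congr ⟨φ.toEquiv, fun {a b} => ?_⟩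
    simp only [SimpleGraph.sup_adj, SimpleGraph.edge_adj, RelIso.coe_fn_toEquiv, hφ]
    have := hinj a b
    have := hinj a w
    have := hinj a u
    have := hinj b w
    have := hinj b u
    grind
  have cA : Nat.card {x : V // x ≠ v ∧ x ≠ w ∧ x ≠ z ∧ K.Adj x v ∧ ¬ K.Adj x w ∧ ¬ K.Adj x z} =
      Nat.card {x : V // x ≠ u ∧ x ≠ v ∧ x ≠ w ∧ x ≠ z ∧
        G.Adj x w ∧ ¬ G.Adj x u ∧ ¬ G.Adj x v} := by
    refine Nat.card_congr (φ.toEquiv.subtypeEquiv fun x => ?_)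
    have := hφ x u
    have := hφ x v
    have := hφ x w
    have := hφ x z
    have := hinj x u
    have := hinj x v
    have := hinj x w
    have := hinj x z
    rw [RelIso.coe_fn_toEquiv]
    grind
  have cA₂ : Nat.card {x : V // x ≠ u ∧ x ≠ z ∧ x ≠ w ∧ K.Adj x u ∧ ¬ K.Adj x z ∧ ¬ K.Adj x w} =
      Nat.card {x : V // x ≠ u ∧ x ≠ v ∧ x ≠ w ∧ x ≠ z ∧
        G.Adj x z ∧ ¬ G.Adj x u ∧ ¬ G.Adj x v} := by
    refine Nat.card_congr (φ.toEquiv.subtypeEquiv fun x => ?_)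
    have := hφ x u
    have := hφ x v
    have := hφ x w
    have := hφ x z
    have := hinj x u
    have := hinj x v
    have := hinj x w
    have := hinj x z
    rw [RelIso.coe_fn_toEquiv]
    grind
  have cB : Nat.card {x : V // x ≠ w ∧ x ≠ v ∧ x ≠ z ∧ K.Adj x w ∧ ¬ K.Adj x v ∧ ¬ K.Adj x z} =
      Nat.card {x : V // x ≠ u ∧ x ≠ v ∧ x ≠ w ∧ x ≠ z ∧
        G.Adj x w ∧ ¬ G.Adj x z ∧ ¬ G.Adj x v} :=
    Nat.card_congr (Equiv.subtypeEquivRight fun x => by grind)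
  have cB₂ : Nat.card {x : V // x ≠ z ∧ x ≠ u ∧ x ≠ w ∧ K.Adj x z ∧ ¬ K.Adj x u ∧ ¬ K.Adj x w} =
      Nat.card {x : V // x ≠ u ∧ x ≠ v ∧ x ≠ w ∧ x ≠ z ∧
        G.Adj x z ∧ ¬ G.Adj x u ∧ ¬ G.Adj x w} :=
    Nat.card_congr (Equiv.subtypeEquivRight fun x => by grind)
  rw [cA, cB] at second
  rw [cA₂, cB₂] at first
  rw [SimpleGraph.edge_comm u w, SimpleGraph.edge_comm v z]
  omega
end
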